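/- Fix symmetric constants $f^\mu_{\alpha\beta}$. On $P = \mathbb{C}[x^\mu, \lambda^\alpha] \otimes \Lambda[\theta^\alpha, v^\mu]$ define the two odd derivations $\mathcal{D} = \lambda^\alpha\partial_{\theta^\alpha} - \lambda^\alpha f^\mu_{\alpha\beta}\theta^\beta \partial_{x^\mu} + v^\mu \partial_{x^\mu} + (\lambda^\alpha f^\mu_{\alpha\beta}\lambda^\beta)\partial_{v^\mu}$ and $d_{\mathrm{dR}} = \lambda^\alpha \partial_{\theta^\alpha} + v^\mu \partial_{x^\mu}$ (summation over repeated indices). Let $\varphi\colon P \to P$ be the algebra automorphism fixing $x^\mu, \lambda^\alpha, \theta^\alpha$ and sending $v^\mu \mapsto v^\mu + \lambda^\alpha f^\mu_{\alpha\beta}\theta^\beta$. Then $\varphi \circ \mathcal{D} = d_{\mathrm{dR}} \circ \varphi$; in particular $(P, \mathcal{D})$ and $(P, d_{\mathrm{dR}})$ are isomorphic complexes and both have cohomology $\mathbb{C}$. -/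

import Mathlib

/-!
STATEMENT 11: On `P = ℂ[xᵘ, λᵃ] ⊗ Λ[θᵃ, vᵘ]`, the pure spinor differential
`𝒟 = λᵃ∂_θᵃ - λᵃf^μ_{αβ}θᵇ∂_xᵘ + vᵘ∂_xᵘ + (λf^μλ)∂_vᵘ` and the de Rham
differential `d = λᵃ∂_θᵃ + vᵘ∂_xᵘ` are intertwined by the algebra
automorphism `φ` fixing `x, λ, θ` and sending `vᵘ ↦ vᵘ + λᵃf^μ_{αβ}θᵇ`:
`φ ∘ 𝒟 = d ∘ φ`.  In particular `𝒟² = 0`, and both complexes have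
cohomology `ℂ` (spanned by the class of `1`).
-/

open MvPolynomial TensorProduct

noncomputable section
set_option synthInstance.maxHeartbeats 1000000
set_option maxHeartbeats 1000000

variable (n m : ℕ) (f : Fin n → Fin m → Fin m → ℂ)

-- even coordinates: `x = X (inl μ)`, `λ = X (inr α)`
abbrev Pev11 (n m : ℕ) := MvPolynomial (Fin n ⊕ Fin m) ℂ
-- odd coordinates: `θ = inl α`, `v = inr μ`
abbrev Odd11 (n m : ℕ) := ExteriorAlgebra ℂ ((Fin m ⊕ Fin n) → ℂ)
abbrev Om11 (n m : ℕ) := Pev11 n m ⊗[ℂ] Odd11 n m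

def thetaGen (α : Fin m) : Odd11 n m :=
  ExteriorAlgebra.ι ℂ (Pi.single (Sum.inl α) 1)
def vGen (μ : Fin n) : Odd11 n m :=
  ExteriorAlgebra.ι ℂ (Pi.single (Sum.inr μ) 1)

/-- the pure spinor differential `𝒟` -/
def Dps : Om11 n m →ₗ[ℂ] Om11 n m :=
  (∑ α : Fin m, TensorProduct.map (LinearMap.mulLeft ℂ (X (Sum.inr α)))
      (CliffordAlgebra.contractLeft (LinearMap.proj (Sum.inl α)))) -
  (∑ μ : Fin n, ∑ α : Fin m, ∑ β : Fin m, f μ α β •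
    TensorProduct.map
      (LinearMap.mulLeft ℂ (X (Sum.inr α)) ∘ₗ (pderiv (Sum.inl μ)).toLinearMap)
      (LinearMap.mulLeft ℂ (thetaGen n m β))) +
  (∑ μ : Fin n, TensorProduct.map (pderiv (Sum.inl μ)).toLinearMap
      (LinearMap.mulLeft ℂ (vGen n m μ))) +
  (∑ μ : Fin n, ∑ α : Fin m, ∑ β : Fin m, f μ α β •
    TensorProduct.map (LinearMap.mulLeft ℂ (X (Sum.inr α) * X (Sum.inr β)))
      (CliffordAlgebra.contractLeft (LinearMap.proj (Sum.inr μ))))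

/-- the de Rham differential `d = Σ λᵃ ∂/∂θᵃ + Σ vᵘ ∂/∂xᵘ` -/
def dR11 : Om11 n m →ₗ[ℂ] Om11 n m :=
  (∑ α : Fin m, TensorProduct.map (LinearMap.mulLeft ℂ (X (Sum.inr α)))
      (CliffordAlgebra.contractLeft (LinearMap.proj (Sum.inl α)))) +
  (∑ μ : Fin n, TensorProduct.map (pderiv (Sum.inl μ)).toLinearMap
      (LinearMap.mulLeft ℂ (vGen n m μ)))

/-- the unit `ℂ → Ω` -/
def i11 : ℂ →ₗ[ℂ] Om11 n m := Algebra.linearMap ℂ (Om11 n m)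

/-- the counit `Ω → ℂ`: evaluation at the origin -/
def p11 : Om11 n m →ₗ[ℂ] ℂ :=
  (TensorProduct.lid ℂ ℂ).toLinearMap ∘ₗ
    TensorProduct.map (lcoeff ℂ 0) (ExteriorAlgebra.algebraMapInv).toLinearMap

/-- The even generators `x`, `λ` as elements of `Om11`. -/
def evenGen (e : Fin n ⊕ Fin m) : Om11 n m := X e ⊗ₜ 1

/-- The odd generators `θ`, `v` as elements of `Om11`. -/
def oddGen (j : Fin m ⊕ Fin n) : Om11 n m := 1 ⊗ₜ ExteriorAlgebra.ι ℂ (Pi.single j 1)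

/-- The set of all coordinates. -/
def gens : Set (Om11 n m) := Set.range (evenGen n m) ∪ Set.range (oddGen n m)

variable {n m}

lemma adjoin_gens : Algebra.adjoin ℂ (gens n m) = ⊤ := by
  have hev : ∀ p : Pev11 n m, (p ⊗ₜ 1 : Om11 n m) ∈ Algebra.adjoin ℂ (gens n m) := by
    intro p
    induction p using MvPolynomial.induction_on with
    | C a =>
      have : ((C a : Pev11 n m) ⊗ₜ 1 : Om11 n m) = algebraMap ℂ _ a := rfl
      exact this ▸ Subalgebra.algebraMap_mem _ a
    | add p q hp hq =>
      rw [TensorProduct.add_tmul]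
      exact add_mem hp hq
    | mul_X p e hp =>
      have : ((p * X e) ⊗ₜ 1 : Om11 n m) = p ⊗ₜ 1 * evenGen n m e := by simp [evenGen]
      exact this ▸ mul_mem hp (Algebra.subset_adjoin (Or.inl ⟨e, rfl⟩))
  have hodd : ∀ q : Odd11 n m, (1 ⊗ₜ q : Om11 n m) ∈ Algebra.adjoin ℂ (gens n m) := by
    intro q
    induction q using ExteriorAlgebra.induction with
    | algebraMap r =>
      have : (1 ⊗ₜ (algebraMap ℂ (Odd11 n m) r) : Om11 n m) = algebraMap ℂ _ r := by
        rw [Algebra.algebraMap_eq_smul_one, Algebra.algebraMap_eq_smul_one,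
          TensorProduct.tmul_smul, Algebra.TensorProduct.one_def]
      exact this ▸ Subalgebra.algebraMap_mem _ r
    | ι v =>
      have : (1 ⊗ₜ (ExteriorAlgebra.ι ℂ v) : Om11 n m) = ∑ j, v j • oddGen n m j := by
        conv_lhs => rw [← (Pi.basisFun ℂ (Fin m ⊕ Fin n)).sum_repr v]
        simp only [map_sum, map_smul, TensorProduct.tmul_sum, TensorProduct.tmul_smul, oddGen,
          Pi.basisFun_apply, Pi.basisFun_repr]
      rw [this]
      exact sum_mem fun j _ =>
        SMulMemClass.smul_mem _ (Algebra.subset_adjoin (Or.inr ⟨j, rfl⟩))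
    | mul a b ha hb =>
      have : (1 ⊗ₜ (a * b) : Om11 n m) = 1 ⊗ₜ a * 1 ⊗ₜ b := by simp
      exact this ▸ mul_mem ha hb
    | add a b ha hb =>
      rw [TensorProduct.tmul_add]
      exact add_mem ha hb
  refine eq_top_iff.2 fun w _ => ?_
  induction w using TensorProduct.induction_on with
  | zero => exact zero_mem _
  | add a b ha hb => exact add_mem (ha trivial) (hb trivial)
  | tmul p q =>
    have : (p ⊗ₜ q : Om11 n m) = p ⊗ₜ 1 * 1 ⊗ₜ q := by simp
    exact this ▸ mul_mem (hev p) (hodd q)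

lemma span_closure_gens :
    Submodule.span ℂ (Submonoid.closure (gens n m) : Set (Om11 n m)) = ⊤ := by
  rw [← Algebra.adjoin_eq_span, adjoin_gens, Algebra.top_toSubmodule]

/-- Linear maps that agree on `1` and whose agreement propagates along left multiplication by
the coordinates are equal. -/
lemma linearMap_ext_gens {A B : Om11 n m →ₗ[ℂ] Om11 n m} (h1 : A 1 = B 1)
    (hev : ∀ e w, A w = B w → A (evenGen n m e * w) = B (evenGen n m e * w))
    (hodd : ∀ j w, A w = B w → A (oddGen n m j * w) = B (oddGen n m j * w)) : A = B := by
  refine LinearMap.ext_on span_closure_gens fun w hw => ?_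
  induction hw using Submonoid.closure_induction_left with
  | one => exact h1
  | mul_left g hg w _ ih =>
    rcases hg with ⟨e, rfl⟩ | ⟨j, rfl⟩
    · exact hev e w ih
    · exact hodd j w ih

/-- `D` satisfies the signed Leibniz rule for left multiplication by the odd element `a`. -/
def SignedLeibniz (D : Om11 n m →ₗ[ℂ] Om11 n m) (a : Om11 n m) : Prop :=
  ∀ w, D (a * w) = D a * w - a * D w

namespace SignedLeibniz

variable {D : Om11 n m →ₗ[ℂ] Om11 n m} {a b : Om11 n m}

lemma add (ha : SignedLeibniz D a) (hb : SignedLeibniz D b) : SignedLeibniz D (a + b) := by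
  intro w
  simp only [add_mul, map_add, ha w, hb w]
  abel

lemma smul (c : ℂ) (ha : SignedLeibniz D a) : SignedLeibniz D (c • a) := by
  intro w
  simp only [smul_mul_assoc, map_smul, ha w, smul_sub]

lemma sum {ι : Type*} (s : Finset ι) {a : ι → Om11 n m} (ha : ∀ i, SignedLeibniz D (a i)) :
    SignedLeibniz D (∑ i ∈ s, a i) := by
  intro w
  simp only [Finset.sum_mul, map_sum, ha _ w, Finset.sum_sub_distrib]

end SignedLeibniz

/-- `D` is an odd derivation, expressed through left multiplication by the coordinates. -/
structure IsOddDerivation (D : Om11 n m →ₗ[ℂ] Om11 n m) : Prop where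
  one : D 1 = 0
  even_mul : ∀ e w, D (evenGen n m e * w) = D (evenGen n m e) * w + evenGen n m e * D w
  odd_mul : ∀ j, SignedLeibniz D (oddGen n m j)

namespace IsOddDerivation

variable {D E : Om11 n m →ₗ[ℂ] Om11 n m}

lemma add (hD : IsOddDerivation D) (hE : IsOddDerivation E) : IsOddDerivation (D + E) where
  one := by simp [hD.one, hE.one]
  even_mul e w := by
    simp only [LinearMap.add_apply, hD.even_mul, hE.even_mul, add_mul, mul_add]
    abel
  odd_mul j w := by
    simp only [LinearMap.add_apply, hD.odd_mul j w, hE.odd_mul j w, add_mul, mul_add]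
    abel

lemma smul (c : ℂ) (hD : IsOddDerivation D) : IsOddDerivation (c • D) where
  one := by simp [hD.one]
  even_mul e w := by
    simp only [LinearMap.smul_apply, hD.even_mul, smul_add, smul_mul_assoc, mul_smul_comm]
  odd_mul j w := by
    simp only [LinearMap.smul_apply, hD.odd_mul j w, smul_sub, smul_mul_assoc, mul_smul_comm]

lemma sub (hD : IsOddDerivation D) (hE : IsOddDerivation E) : IsOddDerivation (D - E) := by
  have : D - E = D + (-1 : ℂ) • E := by module
  exact this ▸ hD.add (hE.smul _)

lemma sum {ι : Type*} (s : Finset ι) {D : ι → Om11 n m →ₗ[ℂ] Om11 n m}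
    (hD : ∀ i, IsOddDerivation (D i)) : IsOddDerivation (∑ i ∈ s, D i) := by
  classical
  induction s using Finset.induction_on with
  | empty => exact ⟨by simp, by simp, fun j w => by simp⟩
  | insert i s hi ih =>
    rw [Finset.sum_insert hi]
    exact (hD i).add ih

lemma even_mul_odd (hD : IsOddDerivation D) (e : Fin n ⊕ Fin m) (j : Fin m ⊕ Fin n) :
    SignedLeibniz D (evenGen n m e * oddGen n m j) := by
  intro w
  rw [mul_assoc, hD.even_mul, hD.even_mul, hD.odd_mul j w]
  simp only [add_mul, mul_sub, mul_assoc]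
  abel

end IsOddDerivation

lemma isOddDerivation_map_contractLeft (c : Pev11 n m) (l : Module.Dual ℂ (Fin m ⊕ Fin n → ℂ)) :
    IsOddDerivation (n := n) (m := m)
      (TensorProduct.map (LinearMap.mulLeft ℂ c) (CliffordAlgebra.contractLeft l)) where
  one := by
    rw [Algebra.TensorProduct.one_def, TensorProduct.map_tmul, CliffordAlgebra.contractLeft_one,
      TensorProduct.tmul_zero]
  even_mul e w := by
    induction w using TensorProduct.induction_on with
    | zero => simp
    | add a b ha hb => rw [mul_add, map_add, ha, hb, map_add, mul_add, mul_add]; abel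
    | tmul p q =>
      simp [evenGen, Algebra.TensorProduct.tmul_mul_tmul, mul_left_comm]
  odd_mul j w := by
    induction w using TensorProduct.induction_on with
    | zero => simp
    | add a b ha hb => rw [mul_add, map_add, ha, hb, map_add, mul_add, mul_add]; abel
    | tmul p q =>
      simp only [oddGen, Algebra.TensorProduct.tmul_mul_tmul, TensorProduct.map_tmul,
        ExteriorAlgebra.ι, CliffordAlgebra.contractLeft_ι_mul, CliffordAlgebra.contractLeft_ι,
        LinearMap.mulLeft_apply, one_mul, mul_one, TensorProduct.tmul_sub, Algebra.smul_def]

lemma isOddDerivation_map_derivation (δ : Derivation ℂ (Pev11 n m) (Pev11 n m))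
    (u : Fin m ⊕ Fin n → ℂ) :
    IsOddDerivation (n := n) (m := m)
      (TensorProduct.map δ.toLinearMap (LinearMap.mulLeft ℂ (ExteriorAlgebra.ι ℂ u))) where
  one := by simp [Algebra.TensorProduct.one_def]
  even_mul e w := by
    induction w using TensorProduct.induction_on with
    | zero => simp
    | add a b ha hb => rw [mul_add, map_add, ha, hb, map_add, mul_add, mul_add]; abel
    | tmul p q =>
      simp [evenGen, Algebra.TensorProduct.tmul_mul_tmul, TensorProduct.add_tmul, mul_comm]
  odd_mul j w := by
    induction w using TensorProduct.induction_on with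
    | zero => simp
    | add a b ha hb => rw [mul_add, map_add, ha, hb, map_add, mul_add, mul_add]; abel
    | tmul p q =>
      have h := eq_neg_of_add_eq_zero_left
        (ExteriorAlgebra.ι_add_mul_swap (R := ℂ) u (Pi.single j 1))
      simp [oddGen, Algebra.TensorProduct.tmul_mul_tmul, ← mul_assoc, h,
        TensorProduct.tmul_neg]

variable (n m) in
/-- The contracting homotopy `Σ θᵃ ∂/∂λᵃ + Σ xᵘ ∂/∂vᵘ`. -/
def eulerHomotopy : Om11 n m →ₗ[ℂ] Om11 n m :=
  (∑ α : Fin m, TensorProduct.map (pderiv (Sum.inr α)).toLinearMap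
      (LinearMap.mulLeft ℂ (thetaGen n m α))) +
  (∑ μ : Fin n, TensorProduct.map (LinearMap.mulLeft ℂ (X (Sum.inl μ)))
      (CliffordAlgebra.contractLeft (LinearMap.proj (Sum.inr μ))))

lemma isOddDerivation_Dps : IsOddDerivation (Dps n m f) := by
  have hfield (μ : Fin n) (α β : Fin m) : IsOddDerivation (n := n) (m := m)
      (TensorProduct.map
        (LinearMap.mulLeft ℂ (X (Sum.inr α)) ∘ₗ (pderiv (Sum.inl μ)).toLinearMap)
        (LinearMap.mulLeft ℂ (thetaGen n m β))) := by
    have : LinearMap.mulLeft ℂ (X (Sum.inr α) : Pev11 n m) ∘ₗ (pderiv (Sum.inl μ)).toLinearMap =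
        ((X (Sum.inr α) : Pev11 n m) • pderiv (R := ℂ) (Sum.inl μ)).toLinearMap := rfl
    rw [this]
    exact isOddDerivation_map_derivation _ _
  rw [Dps]
  refine .add (.add (.sub ?_ ?_) ?_) ?_
  · exact .sum _ fun α => isOddDerivation_map_contractLeft _ _
  · exact .sum _ fun μ => .sum _ fun α => .sum _ fun β => .smul _ (hfield μ α β)
  · exact .sum _ fun μ => isOddDerivation_map_derivation _ _
  · exact .sum _ fun μ => .sum _ fun α => .sum _ fun β =>
      .smul _ (isOddDerivation_map_contractLeft _ _)

lemma isOddDerivation_dR11 : IsOddDerivation (dR11 n m) :=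
  (IsOddDerivation.sum _ fun _ => isOddDerivation_map_contractLeft _ _).add
    (.sum _ fun _ => isOddDerivation_map_derivation _ _)

lemma isOddDerivation_eulerHomotopy : IsOddDerivation (eulerHomotopy n m) :=
  (IsOddDerivation.sum _ fun _ => isOddDerivation_map_derivation _ _).add
    (.sum _ fun _ => isOddDerivation_map_contractLeft _ _)

section values

variable (μ : Fin n) (α : Fin m)

lemma contractLeft_proj_ι_single (i j : Fin m ⊕ Fin n) :
    CliffordAlgebra.contractLeft (LinearMap.proj i)
      (ExteriorAlgebra.ι ℂ (Pi.single j (1 : ℂ)) : Odd11 n m) = if i = j then 1 else 0 := by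
  rw [ExteriorAlgebra.ι, CliffordAlgebra.contractLeft_ι]
  by_cases h : i = j <;> simp [h]

lemma dR11_x : dR11 n m (evenGen n m (Sum.inl μ)) = oddGen n m (Sum.inr μ) := by
  simp [dR11, evenGen, oddGen, vGen, pderiv_X, Pi.single_apply, TensorProduct.ite_tmul]

lemma dR11_lambda : dR11 n m (evenGen n m (Sum.inr α)) = 0 := by
  simp [dR11, evenGen, pderiv_X]

lemma dR11_theta : dR11 n m (oddGen n m (Sum.inl α)) = evenGen n m (Sum.inr α) := by
  simp [dR11, evenGen, oddGen, contractLeft_proj_ι_single, TensorProduct.tmul_ite,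
    -CliffordAlgebra.contractLeft_ι]

lemma dR11_v : dR11 n m (oddGen n m (Sum.inr μ)) = 0 := by
  simp [dR11, oddGen]

lemma eulerHomotopy_x : eulerHomotopy n m (evenGen n m (Sum.inl μ)) = 0 := by
  simp [eulerHomotopy, evenGen, pderiv_X]

lemma eulerHomotopy_lambda :
    eulerHomotopy n m (evenGen n m (Sum.inr α)) = oddGen n m (Sum.inl α) := by
  simp [eulerHomotopy, evenGen, oddGen, thetaGen, pderiv_X, Pi.single_apply,
    TensorProduct.ite_tmul]

lemma eulerHomotopy_theta : eulerHomotopy n m (oddGen n m (Sum.inl α)) = 0 := by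
  simp [eulerHomotopy, oddGen]

lemma eulerHomotopy_v :
    eulerHomotopy n m (oddGen n m (Sum.inr μ)) = evenGen n m (Sum.inl μ) := by
  simp [eulerHomotopy, evenGen, oddGen, contractLeft_proj_ι_single, TensorProduct.tmul_ite,
    -CliffordAlgebra.contractLeft_ι]

lemma Dps_x : Dps n m f (evenGen n m (Sum.inl μ)) = oddGen n m (Sum.inr μ) -
    ∑ α, ∑ β, f μ α β • (evenGen n m (Sum.inr α) * oddGen n m (Sum.inl β)) := by
  simp [Dps, evenGen, oddGen, vGen, thetaGen, pderiv_X, Pi.single_apply, TensorProduct.ite_tmul]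
  abel

lemma Dps_lambda : Dps n m f (evenGen n m (Sum.inr α)) = 0 := by
  simp [Dps, evenGen, pderiv_X]

lemma Dps_theta : Dps n m f (oddGen n m (Sum.inl α)) = evenGen n m (Sum.inr α) := by
  simp [Dps, evenGen, oddGen, contractLeft_proj_ι_single, TensorProduct.tmul_ite,
    -CliffordAlgebra.contractLeft_ι]

lemma Dps_v : Dps n m f (oddGen n m (Sum.inr μ)) =
    ∑ α, ∑ β, f μ α β • (evenGen n m (Sum.inr α) * evenGen n m (Sum.inr β)) := by
  simp [Dps, evenGen, oddGen, contractLeft_proj_ι_single, TensorProduct.tmul_ite,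
    -CliffordAlgebra.contractLeft_ι]

end values

lemma dR11_dR11 (w : Om11 n m) : dR11 n m (dR11 n m w) = 0 := by
  have hd := isOddDerivation_dR11 (n := n) (m := m)
  have : dR11 n m ∘ₗ dR11 n m = 0 := by
    refine linearMap_ext_gens (by simp [hd.one]) ?_ ?_
    · rintro (μ | α) w (h : dR11 n m (dR11 n m w) = 0)
      · simp [hd.even_mul, dR11_x, hd.odd_mul _ w, dR11_v, h]
      · simp [hd.even_mul, dR11_lambda, h]
    · rintro (α | μ) w (h : dR11 n m (dR11 n m w) = 0)
      · simp [hd.odd_mul _ w, hd.odd_mul _ (dR11 n m w), dR11_theta, hd.even_mul, dR11_lambda, h]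
      · simp [hd.odd_mul _ w, hd.odd_mul _ (dR11 n m w), dR11_v, h]
  exact LinearMap.congr_fun this w

variable (n m) in
/-- The Euler operator, counting the number of coordinates in a monomial. -/
def eulerOp : Module.End ℂ (Om11 n m) :=
  dR11 n m ∘ₗ eulerHomotopy n m + eulerHomotopy n m ∘ₗ dR11 n m

lemma eulerOp_apply (w : Om11 n m) : eulerOp n m w =
    dR11 n m (eulerHomotopy n m w) + eulerHomotopy n m (dR11 n m w) := rfl

lemma eulerOp_one : eulerOp n m 1 = 0 := by
  simp [eulerOp_apply, isOddDerivation_dR11.one, isOddDerivation_eulerHomotopy.one]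

lemma eulerOp_gen_mul {g : Om11 n m} (hg : g ∈ gens n m) (w : Om11 n m) :
    eulerOp n m (g * w) = g * w + g * eulerOp n m w := by
  have hd := isOddDerivation_dR11 (n := n) (m := m)
  have hh := isOddDerivation_eulerHomotopy (n := n) (m := m)
  simp only [eulerOp_apply]
  rcases hg with ⟨(μ | α), rfl⟩ | ⟨(α | μ), rfl⟩
  · simp only [hd.even_mul, hh.even_mul, map_add, hh.odd_mul _ _, dR11_x,
      eulerHomotopy_x, eulerHomotopy_v, zero_mul, mul_add, zero_add]
    abel
  · simp only [hd.even_mul, hh.even_mul, map_add, hd.odd_mul _ _, dR11_lambda,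
      eulerHomotopy_lambda, dR11_theta, zero_mul, mul_add, zero_add]
    abel
  · simp only [hd.odd_mul _ _, hh.odd_mul _ _, map_sub, hh.even_mul, dR11_theta,
      eulerHomotopy_lambda, eulerHomotopy_theta, zero_mul, mul_add, zero_sub, map_neg]
    abel
  · simp only [hd.odd_mul _ _, hh.odd_mul _ _, map_sub, hd.even_mul, dR11_v,
      eulerHomotopy_v, dR11_x, zero_mul, mul_add, zero_sub, map_neg]
    abel

lemma dR11_eulerOp (w : Om11 n m) :
    dR11 n m (eulerOp n m w) = eulerOp n m (dR11 n m w) := by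
  simp [eulerOp_apply, dR11_dR11]

variable (n m) in
/-- The counit `p11` as an algebra homomorphism. -/
def counitHom : Om11 n m →ₐ[ℂ] ℂ :=
  Algebra.TensorProduct.lift (aeval 0) ExteriorAlgebra.algebraMapInv fun _ _ => Commute.all _ _

lemma p11_eq (w : Om11 n m) : p11 n m w = counitHom n m w := by
  induction w using TensorProduct.induction_on with
  | zero => simp
  | add a b ha hb => rw [map_add, map_add, ha, hb]
  | tmul p q =>
    simp [p11, counitHom, lcoeff, ← constantCoeff_eq, aeval_zero]

lemma counitHom_evenGen (e : Fin n ⊕ Fin m) : counitHom n m (evenGen n m e) = 0 := by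
  simp [counitHom, evenGen]

lemma counitHom_oddGen (j : Fin m ⊕ Fin n) : counitHom n m (oddGen n m j) = 0 := by
  simp [counitHom, oddGen, ExteriorAlgebra.algebraMapInv]

lemma counitHom_gen {g : Om11 n m} (hg : g ∈ gens n m) : counitHom n m g = 0 := by
  rcases hg with ⟨e, rfl⟩ | ⟨j, rfl⟩
  · exact counitHom_evenGen e
  · exact counitHom_oddGen j

/-- A monomial in the coordinates is `1` or an eigenvector of the Euler operator with positive
eigenvalue. -/
lemma eulerOp_monomial {w : Om11 n m} (hw : w ∈ Submonoid.closure (gens n m)) :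
    w = 1 ∨ counitHom n m w = 0 ∧ ∃ k : ℂ, k ≠ 0 ∧ eulerOp n m w = k • w := by
  suffices w = 1 ∨ counitHom n m w = 0 ∧ ∃ k : ℕ, k ≠ 0 ∧ eulerOp n m w = (k : ℂ) • w from
    this.imp_right fun ⟨h, k, hk, e⟩ => ⟨h, k, Nat.cast_ne_zero.2 hk, e⟩
  induction hw using Submonoid.closure_induction_left with
  | one => exact Or.inl rfl
  | mul_left g hg w _ ih =>
    refine Or.inr ⟨by rw [map_mul, counitHom_gen hg, zero_mul], ?_⟩
    rcases ih with rfl | ⟨-, k, -, hk⟩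
    · exact ⟨1, one_ne_zero, by
        rw [eulerOp_gen_mul hg, eulerOp_one, mul_zero, add_zero, Nat.cast_one, one_smul]⟩
    · refine ⟨k + 1, k.succ_ne_zero, ?_⟩
      rw [eulerOp_gen_mul hg, hk, mul_smul_comm]
      push_cast
      module

open Polynomial in
lemma exists_annihilating_polynomial (w : Om11 n m) :
    ∃ Q : ℂ[X], Q.coeff 0 ≠ 0 ∧
      aeval (eulerOp n m) Q (w - algebraMap ℂ _ (counitHom n m w)) = 0 := by
  have hw : w ∈ Submodule.span ℂ (Submonoid.closure (gens n m) : Set (Om11 n m)) :=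
    span_closure_gens ▸ Submodule.mem_top
  induction hw using Submodule.span_induction with
  | mem w hw =>
    rcases eulerOp_monomial hw with rfl | ⟨h, k, hk, e⟩
    · exact ⟨1, by simp, by rw [map_one (counitHom n m), map_one (algebraMap ℂ _), sub_self, map_zero]⟩
    · refine ⟨Polynomial.X - Polynomial.C k, by simpa using hk, ?_⟩
      simp [h, e, Module.algebraMap_end_apply]
  | zero => exact ⟨1, by simp, by simp⟩
  | add a b _ _ ha hb =>
    obtain ⟨Q, hQ, ha⟩ := ha
    obtain ⟨R, hR, hb⟩ := hb
    refine ⟨Q * R, by simpa [Polynomial.mul_coeff_zero] using ⟨hQ, hR⟩, ?_⟩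
    have : a + b - algebraMap ℂ (Om11 n m) (counitHom n m (a + b)) =
        (a - algebraMap ℂ _ (counitHom n m a)) + (b - algebraMap ℂ _ (counitHom n m b)) := by
      rw [map_add, map_add]; abel
    rw [this, map_add]
    nth_rewrite 1 [mul_comm Q R]
    simp only [map_mul, Module.End.mul_apply, ha, hb, map_zero, add_zero]
  | smul c a _ ha =>
    obtain ⟨Q, hQ, ha⟩ := ha
    refine ⟨Q, hQ, ?_⟩
    have : c • a - algebraMap ℂ (Om11 n m) (counitHom n m (c • a)) =
        c • (a - algebraMap ℂ _ (counitHom n m a)) := by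
      rw [map_smul, smul_eq_mul, map_mul, ← Algebra.smul_def, smul_sub]
    rw [this, map_smul, ha, smul_zero]

open Polynomial in
lemma dR11_aeval_eulerOp (Q : ℂ[X]) (w : Om11 n m) :
    dR11 n m (aeval (eulerOp n m) Q w) = aeval (eulerOp n m) Q (dR11 n m w) := by
  have hc : Commute (dR11 n m : Module.End ℂ (Om11 n m)) (eulerOp n m) :=
    LinearMap.ext dR11_eulerOp
  induction Q using Polynomial.induction_on' with
  | add p q hp hq => simp only [map_add, LinearMap.add_apply, hp, hq]
  | monomial k a =>
    rw [Polynomial.aeval_monomial, ← Algebra.smul_def, LinearMap.smul_apply, LinearMap.smul_apply, map_smul]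
    congr 1
    exact LinearMap.congr_fun (hc.pow_right k) w

lemma dR11_algebraMap (c : ℂ) : dR11 n m (algebraMap ℂ _ c) = 0 := by
  rw [Algebra.algebraMap_eq_smul_one, map_smul, isOddDerivation_dR11.one, smul_zero]

lemma dR11_exact (x : Om11 n m) (hx : dR11 n m x = 0) :
    ∃ y, x - i11 n m (p11 n m x) = dR11 n m y := by
  obtain ⟨Q, hQ, h⟩ := exists_annihilating_polynomial x
  rw [p11_eq, i11, Algebra.linearMap_apply]
  set z := x - algebraMap ℂ (Om11 n m) (counitHom n m x) with hz
  have hdz : dR11 n m z = 0 := by rw [hz, map_sub, hx, dR11_algebraMap, sub_zero]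
  set u := Polynomial.aeval (eulerOp n m) Q.divX z
  have hdu : dR11 n m u = 0 := by rw [dR11_aeval_eulerOp, hdz, map_zero]
  have hsum : eulerOp n m u + Q.coeff 0 • z = 0 := by
    rw [← Polynomial.X_mul_divX_add Q] at h
    simpa only [map_add, map_mul, Polynomial.aeval_X, Polynomial.aeval_C, LinearMap.add_apply,
      Module.End.mul_apply, Module.algebraMap_end_apply] using h
  rw [eulerOp_apply, hdu, map_zero, add_zero] at hsum
  refine ⟨-((Q.coeff 0)⁻¹ • eulerHomotopy n m u), ?_⟩
  rw [map_neg, map_smul, eq_neg_of_add_eq_zero_left hsum, smul_neg, neg_neg, smul_smul,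
    inv_mul_cancel₀ hQ, one_smul]

lemma comp_eq_comp_of_gens {φ : Om11 n m →ₐ[ℂ] Om11 n m} {D E : Om11 n m →ₗ[ℂ] Om11 n m}
    (hD : IsOddDerivation D) (hE : IsOddDerivation E)
    (hφ : ∀ e, φ (evenGen n m e) = evenGen n m e)
    (hφE : ∀ j, SignedLeibniz E (φ (oddGen n m j)))
    (hev : ∀ e, φ (D (evenGen n m e)) = E (evenGen n m e))
    (hodd : ∀ j, φ (D (oddGen n m j)) = E (φ (oddGen n m j))) :
    φ.toLinearMap ∘ₗ D = E ∘ₗ φ.toLinearMap := by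
  refine linearMap_ext_gens (by simp [hD.one, hE.one]) ?_ ?_
  · intro e w h
    simp only [LinearMap.comp_apply, AlgHom.toLinearMap_apply] at h ⊢
    rw [hD.even_mul, map_add, map_mul, map_mul, map_mul, hφ, hE.even_mul, hev, h]
  · intro j w h
    simp only [LinearMap.comp_apply, AlgHom.toLinearMap_apply] at h ⊢
    rw [hD.odd_mul, map_sub, map_mul, map_mul, map_mul, hφE, hodd, h]

instance : Module.Finite ℂ (Odd11 n m) :=
  .of_basis ((Pi.basisFun ℂ (Fin m ⊕ Fin n)).reindex finSumFinEquiv).ExteriorAlgebra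

lemma bijective_of_surjective_of_evenGen {φ : Om11 n m →ₐ[ℂ] Om11 n m}
    (hφ : ∀ e, φ (evenGen n m e) = evenGen n m e) (hs : Function.Surjective φ) :
    Function.Bijective φ := by
  have hev : ∀ p : Pev11 n m, φ (p ⊗ₜ 1) = p ⊗ₜ 1 := by
    have : φ.comp Algebra.TensorProduct.includeLeft = Algebra.TensorProduct.includeLeft :=
      MvPolynomial.algHom_ext hφ
    exact fun p => DFunLike.congr_fun this p
  have hsmul (p : Pev11 n m) (w : Om11 n m) : p • w = p ⊗ₜ 1 * w := by
    induction w using TensorProduct.induction_on with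
    | zero => rw [smul_zero, mul_zero]
    | add a b ha hb => rw [smul_add, mul_add, ha, hb]
    | tmul q r => rw [TensorProduct.smul_tmul', Algebra.TensorProduct.tmul_mul_tmul, one_mul,
        smul_eq_mul]
  let ψ : Om11 n m →ₗ[Pev11 n m] Om11 n m :=
    { toFun := φ
      map_add' := map_add φ
      map_smul' := fun p w => by rw [hsmul, map_mul, hev, RingHom.id_apply, hsmul] }
  exact OrzechProperty.bijective_of_surjective_endomorphism ψ hs

variable (n m)

theorem pure_spinor_differential_is_deRham_in_disguise
    (hf : ∀ μ α β, f μ α β = f μ β α)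
    (φ : Om11 n m →ₐ[ℂ] Om11 n m)
    -- φ fixes the even coordinates x, λ …
    (hφeven : ∀ e : Fin n ⊕ Fin m, φ (X e ⊗ₜ 1) = X e ⊗ₜ 1)
    -- … fixes θ …
    (hφθ : ∀ α : Fin m, φ (1 ⊗ₜ thetaGen n m α) = 1 ⊗ₜ thetaGen n m α)
    -- … and sends vᵘ to vᵘ + λᵃ f^μ_{αβ} θᵇ
    (hφv : ∀ μ : Fin n, φ (1 ⊗ₜ vGen n m μ) =
      1 ⊗ₜ vGen n m μ +
        ∑ α : Fin m, ∑ β : Fin m, f μ α β •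
          (X (Sum.inr α) ⊗ₜ thetaGen n m β)) :
    -- 𝒟 squares to zero
    Dps n m f ∘ₗ Dps n m f = 0 ∧
    -- φ is an automorphism intertwining 𝒟 with the de Rham differential
    Function.Bijective φ ∧
    φ.toLinearMap ∘ₗ Dps n m f = dR11 n m ∘ₗ φ.toLinearMap ∧
    -- and both complexes have cohomology ℂ, spanned by the class of 1
    (∀ x : Om11 n m, dR11 n m x = 0 →
      ∃ y, x - i11 n m (p11 n m x) = dR11 n m y) ∧
    (∀ x : Om11 n m, Dps n m f x = 0 →
      ∃ y, x - i11 n m (p11 n m x) = Dps n m f y) := by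
  have hev : ∀ e, φ (evenGen n m e) = evenGen n m e := hφeven
  have hθ : ∀ α, φ (oddGen n m (Sum.inl α)) = oddGen n m (Sum.inl α) := hφθ
  have hv : ∀ μ, φ (oddGen n m (Sum.inr μ)) = oddGen n m (Sum.inr μ) +
      ∑ α, ∑ β, f μ α β • (evenGen n m (Sum.inr α) * oddGen n m (Sum.inl β)) := by
    intro μ
    simpa [evenGen, oddGen, thetaGen, vGen] using hφv μ
  have hd := isOddDerivation_dR11 (n := n) (m := m)
  have hbij : Function.Bijective φ := by
    refine bijective_of_surjective_of_evenGen hev ?_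
    rw [← AlgHom.range_eq_top, eq_top_iff, ← adjoin_gens, Algebra.adjoin_le_iff]
    rintro _ (⟨e, rfl⟩ | ⟨(α | μ), rfl⟩)
    · exact ⟨_, hev e⟩
    · exact ⟨_, hθ α⟩
    · refine ⟨oddGen n m (Sum.inr μ) -
        ∑ α, ∑ β, f μ α β • (evenGen n m (Sum.inr α) * oddGen n m (Sum.inl β)), ?_⟩
      simp [hv, hev, hθ]
  have hcomp : φ.toLinearMap ∘ₗ Dps n m f = dR11 n m ∘ₗ φ.toLinearMap := by
    refine comp_eq_comp_of_gens (isOddDerivation_Dps f) hd hev ?_ ?_ ?_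
    · rintro (α | μ)
      · rw [hθ]
        exact hd.odd_mul _
      · rw [hv]
        exact (hd.odd_mul _).add
          (.sum _ fun α => .sum _ fun β => .smul _ (hd.even_mul_odd _ _))
    · rintro (μ | α)
      · simp [Dps_x, dR11_x, hv, hev, hθ]
      · simp [Dps_lambda, dR11_lambda]
    · rintro (α | μ)
      · simp [Dps_theta, dR11_theta, hev, hθ]
      · simp [Dps_v, dR11_v, hv, hev, hd.even_mul, dR11_lambda, dR11_theta]
  have hcomp' (w : Om11 n m) : φ (Dps n m f w) = dR11 n m (φ w) := LinearMap.congr_fun hcomp w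
  have hcounit (w : Om11 n m) : counitHom n m (φ w) = counitHom n m w := by
    have : (counitHom n m).comp φ = counitHom n m := by
      refine AlgHom.ext_of_adjoin_eq_top adjoin_gens ?_
      rintro _ (⟨e, rfl⟩ | ⟨(α | μ), rfl⟩)
      · simp [hev]
      · simp [hθ]
      · simp [hv, counitHom_oddGen]
    exact DFunLike.congr_fun this w
  refine ⟨LinearMap.ext fun w => hbij.1 ?_, hbij, hcomp, dR11_exact, fun x hx => ?_⟩
  · simp [hcomp', dR11_dR11]
  · obtain ⟨y, hy⟩ := dR11_exact (φ x) (by rw [← hcomp', hx, map_zero])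
    obtain ⟨z, rfl⟩ := hbij.2 y
    refine ⟨z, hbij.1 ?_⟩
    rw [hcomp', ← hy, map_sub, p11_eq, p11_eq, hcounit, i11, Algebra.linearMap_apply,
      AlgHom.commutes]

end
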